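/- arXiv:quant-ph/0111039 — 2 statements merged into one kernel-verified Lean document; each statement's English description precedes it below -/
import Mathlib

section
/- Let N ≥ 1. The discrete Hartley transform satisfies A_N = ((1−i)/2)·F_N + ((1+i)/2)·F_N^3, where F_N^3 is the third matrix power of the discrete Fourier transform F_N. -/
open Matrix Complex

/-- The discrete Fourier transform matrix `F_N = (1/√N)·[exp(2πi·jk/N)]`. -/
noncomputable def dft (N : ℕ) : Matrix (Fin N) (Fin N) ℂ :=
  Matrix.of fun j k =>
    (1 / (Real.sqrt N : ℂ)) *
      Complex.exp (2 * (Real.pi : ℂ) * Complex.I * ((j.val : ℂ) * (k.val : ℂ)) / (N : ℂ))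

/-- The discrete Hartley transform matrix `A_N = (1/√N)·[cas(2πjk/N)]`, with
`cas(x) = cos(x) + sin(x)`, regarded as a complex matrix. -/
noncomputable def hartley (N : ℕ) : Matrix (Fin N) (Fin N) ℂ :=
  Matrix.of fun j k =>
    (((1 / Real.sqrt N) *
      (Real.cos (2 * Real.pi * (j.val * k.val) / N) +
        Real.sin (2 * Real.pi * (j.val * k.val) / N)) : ℝ) : ℂ)

lemma dft_apply_pow (N : ℕ) (j k : Fin N) : dft N j k =
    (1 / (Real.sqrt N : ℂ)) * (Complex.exp (2 * Real.pi * Complex.I / N)) ^ (j.val * k.val) := by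
  rw [dft, Matrix.of_apply, ← Complex.exp_nat_mul]
  congr 2
  push_cast
  ring

lemma dft_sq_apply (N : ℕ) (hN : 1 ≤ N) (j l : Fin N) :
    (dft N * dft N) j l = if N ∣ j.val + l.val then 1 else 0 := by
  have hz := Complex.isPrimitiveRoot_exp N (by omega)
  have hN0 : (N : ℂ) ≠ 0 := by exact_mod_cast (by omega : N ≠ 0)
  have hc : (1 / (Real.sqrt N : ℂ)) * (1 / (Real.sqrt N : ℂ)) = 1 / N := by
    rw [div_mul_div_comm, ← Complex.ofReal_mul, Real.mul_self_sqrt (by positivity)]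
    simp
  rw [Matrix.mul_apply]
  simp only [dft_apply_pow]
  set z := Complex.exp (2 * Real.pi * Complex.I / N) with hzdef
  have h1 : ∀ m : Fin N, (1 / (Real.sqrt N : ℂ)) * z ^ (j.val * m.val) *
      ((1 / (Real.sqrt N : ℂ)) * z ^ (m.val * l.val)) = 1 / N * (z ^ (j.val + l.val)) ^ m.val := by
    intro m
    rw [← hc, ← pow_mul]
    ring
  simp only [h1]
  rw [← Finset.mul_sum, Fin.sum_univ_eq_sum_range (fun m => (z ^ (j.val + l.val)) ^ m) N]
  split_ifs with h
  · rw [(hz.pow_eq_one_iff_dvd _).2 h]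
    simp [hN0]
  · have hne : z ^ (j.val + l.val) ≠ 1 := fun h' => h ((hz.pow_eq_one_iff_dvd _).1 h')
    rw [geom_sum_eq hne, ← pow_mul, mul_comm (j.val + l.val) N, pow_mul, hz.pow_eq_one]
    simp

lemma dft_cube_apply (N : ℕ) (hN : 1 ≤ N) (j k : Fin N) :
    (dft N ^ 3) j k = (1 / (Real.sqrt N : ℂ)) *
      Complex.exp (-(2 * (Real.pi : ℂ) * ((j.val : ℂ) * (k.val : ℂ)) / (N : ℂ)) * Complex.I) := by
  have hz := Complex.isPrimitiveRoot_exp N (by omega)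
  rw [pow_succ, sq, Matrix.mul_apply]
  simp only [dft_sq_apply N hN]
  have hj := j.isLt
  obtain ⟨l, hl⟩ : ∃ l : Fin N, N ∣ j.val + l.val := by
    by_cases h0 : j.val = 0
    · exact ⟨j, by simp [h0]⟩
    · exact ⟨⟨N - j.val, by omega⟩, by simp [Nat.add_sub_cancel' hj.le]⟩
  rw [Finset.sum_eq_single l]
  · rw [if_pos hl, one_mul, dft_apply_pow]
    congr 1
    have h2 : Complex.exp (2 * Real.pi * Complex.I / N) ^ (j.val * k.val) *
        Complex.exp (2 * Real.pi * Complex.I / N) ^ (l.val * k.val) = 1 := by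
      rw [← pow_add, ← add_mul]
      exact (hz.pow_eq_one_iff_dvd _).2 (hl.mul_right _)
    rw [eq_comm, ← mul_one (Complex.exp (-_ * _)), ← h2, ← mul_assoc, ← Complex.exp_nat_mul,
      ← Complex.exp_add]
    convert one_mul _
    rw [← Complex.exp_zero]
    congr 1
    push_cast
    ring
  · intro m _ hm
    rw [if_neg, zero_mul]
    intro hd
    apply hm
    have h3 : m.val ≡ l.val [MOD N] := by
      apply Nat.ModEq.add_left_cancel' j.val
      exact ((Nat.modEq_zero_iff_dvd).2 hd).trans ((Nat.modEq_zero_iff_dvd).2 hl).symm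
    exact Fin.ext (h3.eq_of_lt_of_lt m.isLt l.isLt)
  · simp

/-- For `N ≥ 1`, the discrete Hartley transform satisfies
`A_N = ((1−i)/2)·F_N + ((1+i)/2)·F_N^3`. -/
theorem hartley_eq_dft_combination (N : ℕ) (hN : 1 ≤ N) :
    hartley N = ((1 - Complex.I) / 2) • dft N + ((1 + Complex.I) / 2) • dft N ^ 3 := by
  ext j k
  rw [Matrix.add_apply, Matrix.smul_apply, Matrix.smul_apply, dft_cube_apply N hN, dft, hartley,
    Matrix.of_apply, Matrix.of_apply]
  have e : 2 * (Real.pi : ℂ) * Complex.I * ((j.val : ℂ) * (k.val : ℂ)) / (N : ℂ) =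
      (2 * (Real.pi : ℂ) * ((j.val : ℂ) * (k.val : ℂ)) / (N : ℂ)) * Complex.I := by ring
  rw [e]
  push_cast
  generalize 2 * (Real.pi : ℂ) * ((j.val : ℂ) * (k.val : ℂ)) / (N : ℂ) = x
  rw [Complex.exp_mul_I, Complex.exp_mul_I, Complex.cos_neg, Complex.sin_neg]
  simp only [smul_eq_mul]
  linear_combination (1 / (Real.sqrt N : ℂ)) * Complex.sin x * Complex.I_sq
end

section
/- Let N ≥ 1. Define the 2×2 matrices H = (1/√2)·[[1,1],[1,−1]] and R = (1/2)·[[1−i, 1+i],[1+i, 1−i]], and the 2N×2N block-diagonal matrix F̌ = I_N ⊕ F_N. Then for every vector x ∈ ℂ^N, (H ⊗ I_N) · F̌^2 · (R ⊗ I_N) · F̌^2 · (I_2 ⊗ F_N) · (H ⊗ I_N) applied to the vector e_0 ⊗ x equals e_0 ⊗ (A_N x), where e_0 = (1,0)^t ∈ ℂ^2. In other words, the quantum circuit consisting of a Hadamard gate on the ancilla qubit, an (unconditional) Fourier transform F_N, a Fourier transform F_N^2 conditioned on the ancilla, the gate R on the ancilla, another conditioned F_N^2, and a final Hadamard on the ancilla,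 maps |0⟩|x⟩ to |0⟩ A_N|x⟩, realizing the discrete Hartley transform with one ancilla qubit. -/
open Matrix Complex

/-- Kronecker product `A ⊗ B` of a 2×2 matrix with an N×N matrix, realized on `Fin (2*N)`
via the standard index identification `i = b·N + x` (most significant part indexes `A`). -/
noncomputable def kron2 {N : ℕ} (A : Matrix (Fin 2) (Fin 2) ℂ) (B : Matrix (Fin N) (Fin N) ℂ) :
    Matrix (Fin (2 * N)) (Fin (2 * N)) ℂ :=
  Matrix.of fun i j =>
    A ⟨i.val / N, Nat.div_lt_of_lt_mul (by have := i.isLt; omega)⟩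
      ⟨j.val / N, Nat.div_lt_of_lt_mul (by have := j.isLt; omega)⟩ *
    B ⟨i.val % N, Nat.mod_lt _ (by have := i.isLt; omega)⟩
      ⟨j.val % N, Nat.mod_lt _ (by have := j.isLt; omega)⟩

/-- Block-diagonal matrix `A ⊕ B` with two N×N diagonal blocks, on `Fin (2*N)`. -/
noncomputable def bdiag {N : ℕ} (A B : Matrix (Fin N) (Fin N) ℂ) :
    Matrix (Fin (2 * N)) (Fin (2 * N)) ℂ :=
  Matrix.of fun i j =>
    if h : i.val < N ∧ j.val < N then A ⟨i.val, h.1⟩ ⟨j.val, h.2⟩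
    else if h' : N ≤ i.val ∧ N ≤ j.val then
      B ⟨i.val - N, by have := i.isLt; omega⟩ ⟨j.val - N, by have := j.isLt; omega⟩
    else 0

/-- The 2×2 Hadamard matrix `H = (1/√2)·[[1,1],[1,−1]]`. -/
noncomputable def Hmat : Matrix (Fin 2) (Fin 2) ℂ :=
  (1 / (Real.sqrt 2 : ℂ)) • !![1, 1; 1, -1]

/-- The 2×2 circulant matrix `R = (1/2)·[[1−i, 1+i],[1+i, 1−i]]`. -/
noncomputable def Rgate : Matrix (Fin 2) (Fin 2) ℂ :=
  (1 / 2 : ℂ) • !![1 - Complex.I, 1 + Complex.I; 1 + Complex.I, 1 - Complex.I]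

/-- The vector `e_0 ⊗ x ∈ ℂ^{2N}`: first `N` coordinates are `x`, last `N` are `0`. -/
def embed0 {N : ℕ} (x : Fin N → ℂ) : Fin (2 * N) → ℂ :=
  fun i => if h : i.val < N then x ⟨i.val, h⟩ else 0


/-- The vector of `ℂ^{2N}` with halves `u` and `v`. -/
noncomputable def pairVec {N : ℕ} (u : Fin 2 → Fin N → ℂ) : Fin (2 * N) → ℂ :=
  fun i => u (finProdFinEquiv.symm i).1 (finProdFinEquiv.symm i).2

lemma kron2_apply' {N : ℕ} (A : Matrix (Fin 2) (Fin 2) ℂ) (B : Matrix (Fin N) (Fin N) ℂ)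
    (p q : Fin 2 × Fin N) :
    kron2 A B (finProdFinEquiv p) (finProdFinEquiv q) = A p.1 q.1 * B p.2 q.2 := by
  have h : ∀ p : Fin 2 × Fin N, (finProdFinEquiv p).val / N = p.1.val ∧
      (finProdFinEquiv p).val % N = p.2.val := by
    intro p
    have := p.2.isLt
    have hN : 0 < N := by omega
    simp [finProdFinEquiv, Nat.add_mul_div_left _ _ hN, Nat.div_eq_of_lt this,
      Nat.mod_eq_of_lt this]
  simp only [kron2, Matrix.of_apply, h]

lemma bdiag_apply' {N : ℕ} (A B : Matrix (Fin N) (Fin N) ℂ)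
    (p q : Fin 2 × Fin N) :
    bdiag A B (finProdFinEquiv p) (finProdFinEquiv q) =
      if p.1 = q.1 then (if p.1 = 0 then A p.2 q.2 else B p.2 q.2) else 0 := by
  obtain ⟨a, b⟩ := p
  obtain ⟨c, d⟩ := q
  have := b.isLt
  have := d.isLt
  fin_cases a <;> fin_cases c <;> simp [bdiag, finProdFinEquiv]

lemma kron2_mulVec {N : ℕ} (A : Matrix (Fin 2) (Fin 2) ℂ) (B : Matrix (Fin N) (Fin N) ℂ)
    (u : Fin 2 → Fin N → ℂ) :
    (kron2 A B).mulVec (pairVec u) =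
      pairVec (fun a => A a 0 • B.mulVec (u 0) + A a 1 • B.mulVec (u 1)) := by
  ext i
  obtain ⟨p, rfl⟩ := finProdFinEquiv.surjective i
  simp only [Matrix.mulVec, dotProduct, pairVec]
  rw [← finProdFinEquiv.sum_comp]
  simp only [kron2_apply', Equiv.symm_apply_apply, Fintype.sum_prod_type, Fin.sum_univ_two,
    Pi.add_apply, Pi.smul_apply, smul_eq_mul, Finset.mul_sum, mul_assoc]
  simp [Matrix.mulVec, dotProduct, Finset.mul_sum]

lemma bdiag_mulVec {N : ℕ} (A B : Matrix (Fin N) (Fin N) ℂ)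
    (u : Fin 2 → Fin N → ℂ) :
    (bdiag A B).mulVec (pairVec u) = pairVec ![A.mulVec (u 0), B.mulVec (u 1)] := by
  ext i
  obtain ⟨⟨a, b⟩, rfl⟩ := finProdFinEquiv.surjective i
  simp only [Matrix.mulVec, dotProduct, pairVec]
  rw [← finProdFinEquiv.sum_comp]
  simp only [bdiag_apply', Equiv.symm_apply_apply, Fintype.sum_prod_type, Fin.sum_univ_two]
  fin_cases a <;> simp [Matrix.mulVec, dotProduct]

lemma embed0_eq {N : ℕ} (x : Fin N → ℂ) : embed0 x = pairVec ![x, 0] := by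
  ext i
  obtain ⟨⟨a, b⟩, rfl⟩ := finProdFinEquiv.surjective i
  have := b.isLt
  simp only [pairVec, Equiv.symm_apply_apply]
  fin_cases a <;> simp [embed0, finProdFinEquiv]

/-- The root of unity. -/
noncomputable def zt (N : ℕ) : ℂ := Complex.exp (2 * Real.pi * Complex.I / N)

lemma dft_apply' (N : ℕ) (j k : Fin N) :
    dft N j k = (1 / (Real.sqrt N : ℂ)) * zt N ^ (j.val * k.val) := by
  simp only [dft, Matrix.of_apply, zt]
  rw [← Complex.exp_nat_mul]
  congr 2
  push_cast
  ring

lemma zt_prim (N : ℕ) [NeZero N] : IsPrimitiveRoot (zt N) N :=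
  Complex.isPrimitiveRoot_exp N (NeZero.ne N)

lemma dvd_iff_neg (N : ℕ) [NeZero N] (j k : Fin N) : N ∣ j.val + k.val ↔ k = -j := by
  rw [eq_neg_iff_add_eq_zero, Fin.ext_iff, Fin.val_add, Nat.dvd_iff_mod_eq_zero, add_comm]
  simp

lemma sq_sqrt_c (N : ℕ) : (Real.sqrt N : ℂ) * (Real.sqrt N : ℂ) = N := by
  rw [← Complex.ofReal_mul, Real.mul_self_sqrt (Nat.cast_nonneg N)]
  simp

lemma dft_sq (N : ℕ) [NeZero N] (j k : Fin N) :
    (dft N * dft N) j k = if k = -j then 1 else 0 := by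
  have hN : (N : ℂ) ≠ 0 := Nat.cast_ne_zero.mpr (NeZero.ne N)
  have hs : (Real.sqrt N : ℂ) ≠ 0 := by
    intro h
    have := sq_sqrt_c N
    rw [h] at this
    exact hN (by simpa using this.symm)
  have h1 : (dft N * dft N) j k
      = (1 / (N : ℂ)) * ∑ l ∈ Finset.range N, (zt N ^ (j.val + k.val)) ^ l := by
    rw [Matrix.mul_apply, ← Fin.sum_univ_eq_sum_range
      (fun l => (zt N ^ (j.val + k.val)) ^ l), Finset.mul_sum]
    refine Finset.sum_congr rfl fun l _ => ?_
    rw [dft_apply', dft_apply', ← sq_sqrt_c N, ← pow_mul, add_mul, pow_add,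
      mul_comm l.val k.val]
    field_simp
  rw [h1]
  by_cases h : k = -j
  · rw [if_pos h, ((zt_prim N).pow_eq_one_iff_dvd _).2 ((dvd_iff_neg N j k).2 h)]
    simp [hN]
  · rw [if_neg h]
    have hz : zt N ^ (j.val + k.val) ≠ 1 := fun hh =>
      h ((dvd_iff_neg N j k).1 (((zt_prim N).pow_eq_one_iff_dvd _).1 hh))
    rw [geom_sum_eq hz, ← pow_mul, mul_comm (_ + _) N, pow_mul, (zt_prim N).pow_eq_one]
    simp

lemma dft_sq_mulVec (N : ℕ) [NeZero N] (v : Fin N → ℂ) :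
    (dft N).mulVec ((dft N).mulVec v) = fun j => v (-j) := by
  ext j
  rw [Matrix.mulVec_mulVec]
  simp [Matrix.mulVec, dotProduct, dft_sq]

lemma dft_hartley (N : ℕ) [NeZero N] (j k : Fin N) :
    (1 - Complex.I) * dft N j k + (1 + Complex.I) * dft N (-j) k = 2 * hartley N j k := by
  have hinv : zt N ^ ((-j).val * k.val) = (zt N ^ (j.val * k.val))⁻¹ := by
    refine eq_inv_of_mul_eq_one_left ?_
    rw [← pow_add, ← add_mul, pow_mul,
      ((zt_prim N).pow_eq_one_iff_dvd _).2, one_pow]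
    rw [add_comm]
    exact (dvd_iff_neg N j (-j)).2 rfl
  have hz : zt N ^ (j.val * k.val) =
      Complex.exp (((2 * Real.pi * (j.val * k.val) / N : ℝ) : ℂ) * Complex.I) := by
    rw [zt, ← Complex.exp_nat_mul]
    congr 1
    push_cast
    ring
  rw [dft_apply', dft_apply', hinv, hz, ← Complex.exp_neg, ← neg_mul]
  simp only [hartley, Matrix.of_apply]
  generalize (2 * Real.pi * (j.val * k.val) / N : ℝ) = t
  rw [Complex.exp_mul_I, Complex.exp_mul_I, Complex.cos_neg, Complex.sin_neg]
  push_cast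
  linear_combination (-2 * (1 / (Real.sqrt N : ℂ)) * Complex.sin t) * Complex.I_sq

lemma hartley_mulVec (N : ℕ) [NeZero N] (x : Fin N → ℂ) (j : Fin N) :
    (1 - Complex.I) * (dft N).mulVec x j + (1 + Complex.I) * (dft N).mulVec x (-j) =
      2 * (hartley N).mulVec x j := by
  simp only [Matrix.mulVec, dotProduct, Finset.mul_sum]
  rw [← Finset.sum_add_distrib]
  refine Finset.sum_congr rfl fun k _ => ?_
  linear_combination x k * dft_hartley N j k

/-- For `N ≥ 1`, with `F̌ = I_N ⊕ F_N`: for every `x ∈ ℂ^N`,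
`(H ⊗ I_N) · F̌² · (R ⊗ I_N) · F̌² · (I_2 ⊗ F_N) · (H ⊗ I_N)` applied to `e_0 ⊗ x`
equals `e_0 ⊗ (A_N x)`; i.e. the quantum circuit maps `|0⟩|x⟩` to `|0⟩ A_N|x⟩`,
realizing the discrete Hartley transform with one ancilla qubit. -/
theorem hartley_circuit (N : ℕ) (hN : 1 ≤ N) (x : Fin N → ℂ) :
    (kron2 Hmat (1 : Matrix (Fin N) (Fin N) ℂ) *
        bdiag (1 : Matrix (Fin N) (Fin N) ℂ) (dft N) ^ 2 *
        kron2 Rgate (1 : Matrix (Fin N) (Fin N) ℂ) *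
        bdiag (1 : Matrix (Fin N) (Fin N) ℂ) (dft N) ^ 2 *
        kron2 (1 : Matrix (Fin 2) (Fin 2) ℂ) (dft N) *
        kron2 Hmat (1 : Matrix (Fin N) (Fin N) ℂ)).mulVec (embed0 x) =
      embed0 ((hartley N).mulVec x) := by
  have : NeZero N := ⟨by omega⟩
  have h2 : (Real.sqrt 2 : ℂ) * (Real.sqrt 2 : ℂ) = 2 := by
    exact_mod_cast sq_sqrt_c 2
  have hs : (Real.sqrt 2 : ℂ)⁻¹ * (Real.sqrt 2 : ℂ)⁻¹ = 1 / 2 := by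
    rw [← mul_inv, h2, one_div]
  have h3 : (dft N * (dft N * dft N)).mulVec x = fun j => (dft N).mulVec x (-j) := by
    simp only [← Matrix.mulVec_mulVec]
    exact dft_sq_mulVec N _
  have h5 : (dft N * dft N).mulVec (fun j => (dft N).mulVec x (-j)) = (dft N).mulVec x := by
    rw [← Matrix.mulVec_mulVec, dft_sq_mulVec]
    simp
  simp only [pow_two, ← Matrix.mulVec_mulVec, embed0_eq, kron2_mulVec, bdiag_mulVec]
  congr 1
  ext a j
  have key := hartley_mulVec N x j
  fin_cases a
  · simp [Hmat, Rgate, Matrix.mulVec_add, Matrix.mulVec_smul, h3, h5]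
    linear_combination (1 / 2) * key + hs * ((1 - Complex.I) * (dft N).mulVec x j + (1 + Complex.I) * (dft N).mulVec x (-j))
  · simp [Hmat, Rgate, Matrix.mulVec_add, Matrix.mulVec_smul, h3, h5]
    try ring
end
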